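/- Let (R, m) be a commutative Noetherian local ring and N a nonzero finitely generated rigid-test R-module. If pd(N) < ∞ or id(N) < ∞, then R is regular. -/

import Mathlib

open CategoryTheory

noncomputable section

variable (R : Type) [CommRing R]

/-- `Ext^n_R(M,N)` as an `R`-module object. -/
abbrev ext (n : ℕ) (M N : ModuleCat R) : ModuleCat R :=
  ((Ext R (ModuleCat R) n).obj (Opposite.op M)).obj N

/-- `Tor_n^R(M,N)`. -/
abbrev tor (n : ℕ) (M N : ModuleCat R) : ModuleCat R :=
  ((Tor (ModuleCat R) n).obj M).obj N

/-- projective dimension, via vanishing of `Ext` in degrees above `n`. -/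
def projDim (M : ModuleCat R) : ℕ∞ :=
  sInf {n : ℕ∞ | ∀ (i : ℕ) (X : ModuleCat R), n < i → Subsingleton (ext R i M X)}

/-- injective dimension, via vanishing of `Ext` in degrees above `n`. -/
def injDim (N : ModuleCat R) : ℕ∞ :=
  sInf {n : ℕ∞ | ∀ (i : ℕ) (X : ModuleCat R), n < i → Subsingleton (ext R i X N)}

/-- depth over a local ring, as the least `n` with `Ext^n(k, N) ≠ 0`. -/
def depth [IsLocalRing R] (N : ModuleCat R) : ℕ∞ :=
  sInf {n : ℕ∞ | ∃ i : ℕ, n = i ∧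
    ¬ Subsingleton (ext R i (ModuleCat.of R (IsLocalRing.ResidueField R)) N)}

/-- Tor-rigidity. -/
def TorRigid (N : ModuleCat R) : Prop :=
  ∀ (X : ModuleCat R), Module.Finite R X → ∀ n : ℕ, 1 ≤ n →
    Subsingleton (tor R n N X) → Subsingleton (tor R (n + 1) N X)

/-- test module for projectivity. -/
def TestModule (M : ModuleCat R) : Prop :=
  ∀ (X : ModuleCat R), Module.Finite R X → projDim R X = ⊤ →
    {j : ℕ | ¬ Subsingleton (tor R j M X)}.Infinite

/-- strongly-rigid module. -/
def StronglyRigid (N : ModuleCat R) : Prop :=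
  ∀ (X : ModuleCat R), Module.Finite R X → ∀ n : ℕ, 1 ≤ n →
    Subsingleton (tor R n N X) → projDim R X < ⊤

/-- rigid-test module. -/
def RigidTest (N : ModuleCat R) : Prop :=
  ∀ (X : ModuleCat R), Module.Finite R X → ∀ n : ℕ, 1 ≤ n →
    Subsingleton (tor R n N X) →
      Subsingleton (tor R (n + 1) N X) ∧ projDim R X < ⊤



open Abelian in
lemma ext_iff_cocycle {X Y : ModuleCat.{0} R} (P : ProjectiveResolution X) (n : ℕ) :
    Subsingleton (Ext.{0} X Y (n+1)) ↔ ∀ f : P.complex.X (n+1) ⟶ Y, P.complex.d (n+2) (n+1) ≫ f = 0 →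
      ∃ g : P.complex.X n ⟶ Y, P.complex.d (n+1) n ≫ g = f := by
  constructor
  · intro h f hf
    exact (P.extMk_eq_zero_iff f (n+2) rfl hf n rfl).1 (Subsingleton.elim _ _)
  · intro h
    refine subsingleton_of_forall_eq 0 fun α => ?_
    obtain ⟨f, hf, rfl⟩ := P.extMk_surjective α (n+2) rfl
    exact (P.extMk_eq_zero_iff f (n+2) rfl hf n rfl).2 (h f hf)

lemma oldext_iff_cocycle {X Y : ModuleCat.{0} R} (P : ProjectiveResolution X) (n : ℕ) :
    Subsingleton (ext R (n+1) X Y) ↔ ∀ f : P.complex.X (n+1) ⟶ Y, P.complex.d (n+2) (n+1) ≫ f = 0 →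
      ∃ g : P.complex.X n ⟶ Y, P.complex.d (n+1) n ≫ g = f := by
  rw [← ModuleCat.isZero_iff_subsingleton, (P.isoExt (n+1) Y).isZero_iff,
    ← HomologicalComplex.exactAt_iff_isZero_homology,
    HomologicalComplex.exactAt_iff' _ n (n+1) (n+2) (by simp) (by simp),
    ShortComplex.moduleCat_exact_iff]
  exact Iff.rfl

open MonoidalCategory in
lemma tor_iff {N X : ModuleCat.{0} R} (P : ProjectiveResolution X) (n : ℕ) :
    Subsingleton (tor R (n+1) N X) ↔ 
      Function.Exact ((P.complex.d (n+2) (n+1)).hom.lTensor N) ((P.complex.d (n+1) n).hom.lTensor N) := by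
  rw [← ModuleCat.isZero_iff_subsingleton]
  refine (P.isoLeftDerivedObj ((tensoringLeft (ModuleCat.{0} R)).obj N) (n+1)).isZero_iff.trans ?_
  refine (HomologicalComplex.exactAt_iff_isZero_homology _ _).symm.trans ?_
  rw [HomologicalComplex.exactAt_iff' _ (n+2) (n+1) n (by simp) (by simp),
    ShortComplex.ShortExact.moduleCat_exact_iff_function_exact]
  exact Iff.rfl

lemma pi_exact {X : ModuleCat.{0} R} (P : ProjectiveResolution X) :
    ∃ p : P.complex.X 0 ⟶ X, Function.Exact (P.complex.d 1 0) p ∧ Function.Surjective p := by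
  refine ⟨P.π.f 0, ?_, ?_⟩
  · exact (ShortComplex.ShortExact.moduleCat_exact_iff_function_exact _).1 P.exact₀
  · exact (ModuleCat.epi_iff_surjective _).1 (inferInstanceAs (Epi (P.π.f 0)))

lemma d_exact {X : ModuleCat.{0} R} (P : ProjectiveResolution X) (n : ℕ) :
    Function.Exact (P.complex.d (n+2) (n+1)) (P.complex.d (n+1) n) :=
  (ShortComplex.ShortExact.moduleCat_exact_iff_function_exact _).1 (P.exact_succ n)

lemma mkRes {X : ModuleCat.{0} R} (C : ChainComplex (ModuleCat.{0} R) ℕ) (hC : ∀ n, Projective (C.X n))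
    (p : C.X 0 ⟶ X) (h0 : Function.Exact (C.d 1 0) p) (hp : Function.Surjective p)
    (h : ∀ n, Function.Exact (C.d (n+2) (n+1)) (C.d (n+1) n)) :
    ∃ Q : ProjectiveResolution X, Q.complex = C := by
  have w : C.d 1 0 ≫ p = 0 := by
    ext x
    exact h0.apply_apply_eq_zero x
  refine ⟨{ complex := C, π := (ChainComplex.toSingle₀Equiv _ _).symm ⟨p, w⟩, quasiIso := ⟨fun n => ?_⟩ }, rfl⟩
  cases n with
  | zero =>
    rw [ChainComplex.quasiIsoAt₀_iff, ShortComplex.quasiIso_iff_of_zeros']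
    · refine (ShortComplex.exact_and_epi_g_iff_of_iso (S₂ := ShortComplex.mk (C.d 1 0) p w) ?_).2 ⟨?_, ?_⟩
      · exact ShortComplex.isoMk (Iso.refl _) (Iso.refl _) (Iso.refl _)
          ((Category.id_comp _).trans (Category.comp_id _).symm)
          ((Category.id_comp _).trans ((ChainComplex.toSingle₀Equiv_symm_apply_f_zero _ _).symm.trans
            (Category.comp_id _).symm))
      · exact (ShortComplex.ShortExact.moduleCat_exact_iff_function_exact _).2 h0
      · exact (ModuleCat.epi_iff_surjective _).2 hp
    all_goals first | rfl | exact C.shape 0 0 (by simp)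
  | succ n =>
    rw [quasiIsoAt_iff_exactAt']
    · rw [HomologicalComplex.exactAt_iff' _ (n+2) (n+1) n (by simp) (by simp)]
      exact (ShortComplex.ShortExact.moduleCat_exact_iff_function_exact _).2 (h n)
    · apply ChainComplex.exactAt_succ_single_obj

lemma splice (S : ShortComplex (ModuleCat.{0} R)) (hS : S.ShortExact) [Projective S.X₂]
    (P : ProjectiveResolution S.X₁) (p : P.complex.X 0 ⟶ S.X₁)
    (hp0 : Function.Exact (P.complex.d 1 0) p) (hp : Function.Surjective p) (w : P.complex.d 1 0 ≫ p ≫ S.f = 0) :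
    ∃ Q : ProjectiveResolution S.X₃, Q.complex = P.complex.augment (p ≫ S.f) w := by
  have hex := (ShortComplex.ShortExact.moduleCat_exact_iff_function_exact _).1 hS.exact
  have hinj := (ModuleCat.mono_iff_injective _).1 hS.mono_f
  have hsurj := (ModuleCat.epi_iff_surjective _).1 hS.epi_g
  refine mkRes R _ ?_ (show S.X₂ ⟶ S.X₃ from S.g) ?_ hsurj ?_
  · rintro (_ | n)
    · exact inferInstanceAs (Projective S.X₂)
    · exact inferInstanceAs (Projective (P.complex.X n))
  · intro x
    refine (hex x).trans ?_
    constructor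
    · rintro ⟨y, rfl⟩
      obtain ⟨z, rfl⟩ := hp y
      exact ⟨z, rfl⟩
    · rintro ⟨z, rfl⟩
      exact ⟨p z, rfl⟩
  · rintro (_ | n)
    · intro x
      refine Iff.trans ?_ (hp0 x)
      change S.f (p x) = 0 ↔ _
      rw [← map_zero S.f.hom]
      exact hinj.eq_iff
    · exact d_exact R P n

lemma tor_succ (N : ModuleCat.{0} R) (S : ShortComplex (ModuleCat.{0} R)) (hS : S.ShortExact) [Projective S.X₂] (n : ℕ) :
    Subsingleton (tor R (n+2) N S.X₃) ↔ Subsingleton (tor R (n+1) N S.X₁) := by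
  let P := projectiveResolution S.X₁
  obtain ⟨p, hp0, hp⟩ := pi_exact R P
  have w : P.complex.d 1 0 ≫ p ≫ S.f = 0 := by
    ext x
    simp [hp0.apply_apply_eq_zero]
  obtain ⟨Q, hQ⟩ := splice R S hS P p hp0 hp w
  rw [tor_iff R Q, tor_iff R P, hQ]
  exact Iff.rfl

lemma tor_one (N : ModuleCat.{0} R) (S : ShortComplex (ModuleCat.{0} R)) (hS : S.ShortExact) [Projective S.X₂] :
    Subsingleton (tor R 1 N S.X₃) ↔ Function.Injective (S.f.hom.lTensor N) := by
  let P := projectiveResolution S.X₁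
  obtain ⟨p, hp0, hp⟩ := pi_exact R P
  have w : P.complex.d 1 0 ≫ p ≫ S.f = 0 := by
    ext x
    simp [hp0.apply_apply_eq_zero]
  obtain ⟨Q, hQ⟩ := splice R S hS P p hp0 hp w
  rw [tor_iff R Q, hQ]
  have e1 : Function.Exact ((P.complex.d 1 0).hom.lTensor N) (p.hom.lTensor N) := lTensor_exact N hp0 hp
  have e2 : Function.Surjective (p.hom.lTensor N) := LinearMap.lTensor_surjective N hp
  change Function.Exact ((P.complex.d 1 0).hom.lTensor N) ((p ≫ S.f).hom.lTensor N) ↔ _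
  rw [ModuleCat.hom_comp, LinearMap.lTensor_comp]
  rw [injective_iff_map_eq_zero]
  constructor
  · intro h x hx
    obtain ⟨y, rfl⟩ := e2 x
    exact (e1 y).2 ((h y).1 hx)
  · intro h y
    rw [← e1 y]
    exact ⟨fun hy => h _ hy, fun hy => by simp [hy]⟩

lemma projDim_lt_top_iff (X : ModuleCat.{0} R) :
    projDim R X < ⊤ ↔ ∃ n, HasProjectiveDimensionLT X n := by
  have key (i : ℕ) (Y : ModuleCat.{0} R) : Subsingleton (ext R (i+1) X Y) ↔ Subsingleton (Abelian.Ext.{0} X Y (i+1)) :=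
    (oldext_iff_cocycle R (projectiveResolution X) i).trans (ext_iff_cocycle R (projectiveResolution X) i).symm
  rw [projDim, sInf_lt_iff]
  constructor
  · rintro ⟨a, ha, hlt⟩
    lift a to ℕ using hlt.ne
    refine ⟨a + 1, HasProjectiveDimensionLT.mk (n := a + 1) fun i hi Y e => ?_⟩
    obtain ⟨j, rfl⟩ : ∃ j, i = j + 1 := ⟨i - 1, by omega⟩
    have := (key j Y).1 (ha (j+1) Y (by exact_mod_cast hi))
    exact Subsingleton.elim _ _
  · rintro ⟨n, hn⟩
    refine ⟨n, fun i Y hi => ?_, ENat.natCast_lt_top n⟩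
    have hi' : n < i := by exact_mod_cast hi
    obtain ⟨j, rfl⟩ : ∃ j, i = j + 1 := ⟨i - 1, by omega⟩
    exact (key j Y).2 (HasProjectiveDimensionLT.subsingleton X n _ hi'.le Y)

lemma injDim_lt_top (N : ModuleCat.{0} R) (h : injDim R N < ⊤) :
    ∃ d : ℕ, ∀ (X : ModuleCat.{0} R) (i : ℕ), d < i → Subsingleton (Abelian.Ext.{0} X N i) := by
  rw [injDim, sInf_lt_iff] at h
  obtain ⟨a, ha, hlt⟩ := h
  lift a to ℕ using hlt.ne
  refine ⟨a, fun X i hi => ?_⟩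
  obtain ⟨j, rfl⟩ : ∃ j, i = j + 1 := ⟨i - 1, by omega⟩
  exact (ext_iff_cocycle R (projectiveResolution X) j).2
    ((oldext_iff_cocycle R (projectiveResolution X) j).1 (ha (j+1) X (by exact_mod_cast hi)))

open Abelian in
lemma ext_shift (S : ShortComplex (ModuleCat.{0} R)) (hS : S.ShortExact) [Projective S.X₂] (L : ModuleCat.{0} R) (n : ℕ) :
    Subsingleton (Ext.{0} S.X₁ L (n + 1)) ↔ Subsingleton (Ext.{0} S.X₃ L (n + 2)) := by
  have (m : ℕ) : Subsingleton (Ext.{0} S.X₂ L (m + 1)) := Ext.subsingleton_of_projective S.X₂ L m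
  constructor
  · intro h
    refine subsingleton_of_forall_eq 0 fun x => ?_
    obtain ⟨y, rfl⟩ := Ext.contravariant_sequence_exact₃ hS L x (Subsingleton.elim _ _) (n₀ := n+1) (add_comm 1 _)
    rw [Subsingleton.elim y 0, Ext.comp_zero]
  · intro h
    refine subsingleton_of_forall_eq 0 fun x => ?_
    obtain ⟨y, rfl⟩ := Ext.contravariant_sequence_exact₁ hS L x (n₁ := n+2) (add_comm 1 _) (Subsingleton.elim _ _)
    rw [Subsingleton.elim y 0, Ext.comp_zero]

open Abelian in
lemma ext_one_iff (S : ShortComplex (ModuleCat.{0} R)) (hS : S.ShortExact) [Projective S.X₂] (L : ModuleCat.{0} R) :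
    Subsingleton (Ext.{0} S.X₃ L 1) ↔ ∀ g : S.X₁ ⟶ L, ∃ h : S.X₂ ⟶ L, S.f ≫ h = g := by
  have : Subsingleton (Ext.{0} S.X₂ L 1) := Ext.subsingleton_of_projective S.X₂ L 0
  constructor
  · intro h g
    obtain ⟨y, hy⟩ := Ext.contravariant_sequence_exact₁ hS L (Ext.mk₀ g) (n₁ := 1) (add_zero 1) (Subsingleton.elim _ _)
    obtain ⟨h, rfl⟩ := (Ext.mk₀_bijective _ _).2 y
    rw [Ext.mk₀_comp_mk₀, (Ext.mk₀_bijective _ _).1.eq_iff] at hy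
    exact ⟨h, hy⟩
  · intro h
    refine subsingleton_of_forall_eq 0 fun x => ?_
    obtain ⟨y, rfl⟩ := Ext.contravariant_sequence_exact₃ hS L x (Subsingleton.elim _ _) (n₀ := 0) (add_zero 1)
    obtain ⟨g, rfl⟩ := (Ext.mk₀_bijective _ _).2 y
    obtain ⟨h, rfl⟩ := h g
    rw [← Ext.mk₀_comp_mk₀]
    exact hS.extClass_comp_assoc _

/-- finite projective dimension kills Tor in high degrees -/
lemma tor_vanish_aux {X : ModuleCat.{0} R} (P : ProjectiveResolution X) (n : ℕ) : ∀ (N : ModuleCat.{0} R),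
    HasProjectiveDimensionLT N (n+1) → ∀ j, n ≤ j →
     Function.Exact ((P.complex.d (j+2) (j+1)).hom.lTensor N) ((P.complex.d (j+1) j).hom.lTensor N) := by
  induction n with
  | zero =>
    intro N hN j _
    have : Projective N := projective_iff_hasProjectiveDimensionLT_one.2 hN
    have : Module.Projective R N := (IsProjective.iff_projective N).2 this
    exact Module.Flat.lTensor_exact N (d_exact R P j)
  | succ n ih =>
    intro N hN j hj
    obtain ⟨j, rfl⟩ : ∃ k, j = k + 1 := ⟨j - 1, by omega⟩
    obtain ⟨Q, _, _, _, f, hf⟩ : ∃ (Q : Type) (_ : AddCommGroup Q) (_ : Module R Q) (_ : Module.Projective R Q)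
        (f : Q →ₗ[R] N), Function.Surjective f :=
      ⟨N →₀ R, inferInstance, inferInstance, inferInstance, Finsupp.linearCombination R id,
        Finsupp.linearCombination_id_surjective R N⟩
    have hS := LinearMap.shortExact_shortComplexKer hf
    have hQ : Projective (ModuleCat.of R Q) := (IsProjective.iff_projective _).1 inferInstance
    have hK := (hS.hasProjectiveDimensionLT_X₃_iff n hQ).1 hN
    have IH := ih _ hK j (by omega)
    have hflat (i : ℕ) : Module.Flat R (P.complex.X i) := by
      have : Module.Projective R (P.complex.X i) := (IsProjective.iff_projective _).2 (P.projective i)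
      infer_instance
    let i : LinearMap.ker f →ₗ[R] Q := (LinearMap.ker f).subtype
    have hi (m : ℕ) : Function.Injective (i.rTensor (P.complex.X m)) :=
      Module.Flat.rTensor_preserves_injective_linearMap _ (LinearMap.ker f).injective_subtype
    have he (m : ℕ) : Function.Exact (i.rTensor (P.complex.X m)) (f.rTensor (P.complex.X m)) :=
      rTensor_exact _ (fun x => by simp [i]) hf
    have hs (m : ℕ) : Function.Surjective (f.rTensor (P.complex.X m)) := LinearMap.rTensor_surjective _ hf
    have hQe (m : ℕ) := Module.Flat.lTensor_exact Q (d_exact R P m)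
    have cf (m m' : ℕ) (x) : f.rTensor _ ((P.complex.d m m').hom.lTensor Q x) =
        (P.complex.d m m').hom.lTensor N (f.rTensor _ x) := by
      rw [← LinearMap.comp_apply, ← LinearMap.comp_apply, LinearMap.rTensor_comp_lTensor, LinearMap.lTensor_comp_rTensor]
    have ci (m m' : ℕ) (x) : i.rTensor _ ((P.complex.d m m').hom.lTensor (LinearMap.ker f) x) =
        (P.complex.d m m').hom.lTensor Q (i.rTensor _ x) := by
      rw [← LinearMap.comp_apply, ← LinearMap.comp_apply, LinearMap.rTensor_comp_lTensor, LinearMap.lTensor_comp_rTensor]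
    intro x
    constructor
    · intro hx
      obtain ⟨y, rfl⟩ := hs _ x
      rw [← cf] at hx
      obtain ⟨z, hz⟩ := (he _ _).1 hx
      have h1 : (P.complex.d (j+1) j).hom.lTensor (LinearMap.ker f) z = 0 := by
        apply hi
        rw [ci, hz, map_zero]
        exact (hQe j).apply_apply_eq_zero y
      obtain ⟨u, rfl⟩ := (IH z).1 h1
      rw [ci] at hz
      have h2 : (P.complex.d (j+2) (j+1)).hom.lTensor Q (y - i.rTensor _ u) = 0 := by
        rw [map_sub, ← hz, sub_self]
      obtain ⟨v, hv⟩ := (hQe (j+1) _).1 h2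
      refine ⟨f.rTensor _ v, ?_⟩
      rw [← cf]
      have := congrArg (f.rTensor _) hv
      rw [map_sub, (he _).apply_apply_eq_zero, sub_zero] at this
      exact this
    · rintro ⟨y, rfl⟩
      obtain ⟨y, rfl⟩ := hs _ y
      rw [← cf, ← cf]
      have := (hQe (j+1)).apply_apply_eq_zero y
      exact (congrArg (f.rTensor _) this).trans (map_zero _)

lemma pd_case [IsNoetherianRing R] [IsLocalRing R] (N : ModuleCat.{0} R)
    (hrt : RigidTest R N) (h : projDim R N < ⊤) :
    projDim R (ModuleCat.of R (IsLocalRing.ResidueField R)) < ⊤ := by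
  obtain ⟨n, hn⟩ := (projDim_lt_top_iff R N).1 h
  have hn1 : HasProjectiveDimensionLT N (n+1) := hasProjectiveDimensionLT_of_ge N n (n+1) (by omega)
  refine (hrt (ModuleCat.of R (IsLocalRing.ResidueField R)) ?_ (n+1) (by omega) ?_).2
  · exact inferInstanceAs (Module.Finite R (IsLocalRing.ResidueField R))
  · exact (tor_iff R (projectiveResolution _) n).2 (tor_vanish_aux R _ n N hn1 n le_rfl)

open TensorProduct in
lemma subsingleton_of_tensor [IsLocalRing R] (N M : Type) [AddCommGroup N] [Module R N] [AddCommGroup M] [Module R M]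
    [Module.Finite R N] [Module.Finite R M] [Nontrivial N] (h : Subsingleton (N ⊗[R] M)) : Subsingleton M := by
  let k := IsLocalRing.ResidueField R
  have h1 : Nontrivial (k ⊗[R] N) := by
    rw [← not_subsingleton_iff_nontrivial, IsLocalRing.subsingleton_tensorProduct]
    exact not_subsingleton N
  obtain ⟨v, hv⟩ := exists_ne (0 : k ⊗[R] N)
  obtain ⟨φ, hφ⟩ := Module.Projective.exists_dual_ne_zero k hv
  have hφs : Function.Surjective φ := by
    intro c
    refine ⟨(c * (φ v)⁻¹) • v, ?_⟩
    rw [map_smul, smul_eq_mul, mul_assoc, inv_mul_cancel₀ hφ, mul_one]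
  let ψ : N →ₗ[R] k := (φ.restrictScalars R).comp (TensorProduct.mk R k N 1)
  have hψ : Function.Surjective ψ := by
    intro c
    obtain ⟨w, rfl⟩ := hφs c
    obtain ⟨x, rfl⟩ := TensorProduct.mk_surjective R N k Ideal.Quotient.mk_surjective w
    exact ⟨x, rfl⟩
  have : Subsingleton (k ⊗[R] M) := (LinearMap.rTensor_surjective M hψ).subsingleton
  exact IsLocalRing.subsingleton_tensorProduct.1 this

open TensorProduct in
/-- the evaluation map `N ⊗ M^* → Hom(M,N)` -/
def theta (N M : Type) [AddCommGroup N] [Module R N] [AddCommGroup M] [Module R M] :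
    N ⊗[R] Module.Dual R M →ₗ[R] (M →ₗ[R] N) :=
  (dualTensorHom R M N) ∘ₗ (TensorProduct.comm R N (Module.Dual R M)).toLinearMap

lemma theta_bijective (N M : Type) [AddCommGroup N] [Module R N] [AddCommGroup M] [Module R M]
    [Module.Finite R M] [Module.Projective R M] : Function.Bijective (theta R N M) := by
  unfold theta
  rw [LinearMap.coe_comp]
  exact dualTensorHom_bijective.comp (TensorProduct.comm R N (Module.Dual R M)).bijective

open TensorProduct in
lemma theta_nat (N : Type) {M M' : Type} [AddCommGroup N] [Module R N] [AddCommGroup M] [Module R M]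
    [AddCommGroup M'] [Module R M'] (f : M →ₗ[R] M') (z : N ⊗[R] Module.Dual R M') :
    theta R N M (f.dualMap.lTensor N z) = (theta R N M' z).comp f := by
  induction z with
  | zero => simp
  | add x y hx hy => simp only [map_add, hx, hy, LinearMap.add_comp]
  | tmul n φ => ext; simp [theta]

set_option maxHeartbeats 1000000 in
/-- Key lemma -/
lemma keyA [IsNoetherianRing R] [IsLocalRing R] (N : ModuleCat.{0} R) [Module.Finite R N] [Nontrivial N]
    (hrt : RigidTest R N) (Y F : Type) [AddCommGroup Y] [Module R Y] [AddCommGroup F] [Module R F] [Module.Finite R F]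
    [Module.Finite R Y] [Module.Projective R F] (i : Y →ₗ[R] F) 
    (hN : ∀ g : Y →ₗ[R] N, ∃ h : F →ₗ[R] N, h.comp i = g) :
    Function.Surjective i.dualMap ∧ ∃ n, HasProjectiveDimensionLT (ModuleCat.of R (Module.Dual R Y)) n := by
  obtain ⟨a, q, hq⟩ := Module.Finite.exists_fin' R Y
  obtain ⟨b, r', hr'⟩ := Module.Finite.exists_fin' R (LinearMap.ker q)
  let r : (Fin b → R) →ₗ[R] (Fin a → R) := (LinearMap.ker q).subtype.comp r'
  have hqr : Function.Exact r q := by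
    intro x
    constructor
    · intro hx
      obtain ⟨y, hy⟩ := hr' ⟨x, hx⟩
      exact ⟨y, by simp [r, hy]⟩
    · rintro ⟨y, rfl⟩
      exact (r' y).2
  -- factorization
  have key (y : TensorProduct R N (Module.Dual R (Fin a → R))) (hy : r.dualMap.lTensor N y = 0) :
      ∃ w, y = q.dualMap.lTensor N (i.dualMap.lTensor N w) := by
    have h1 : (theta R N _ y).comp r = 0 := by rw [← theta_nat, hy, map_zero]
    have h2 : ∃ g : Y →ₗ[R] N, g.comp q = theta R N _ y := by
      have hle : LinearMap.ker q ≤ LinearMap.ker (theta R N _ y) := by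
        intro x hx
        obtain ⟨z, rfl⟩ := (hqr x).1 hx
        exact LinearMap.congr_fun h1 z
      refine ⟨((LinearMap.ker q).liftQ _ hle).comp (q.quotKerEquivOfSurjective hq).symm.toLinearMap, ?_⟩
      ext x
      have : (q.quotKerEquivOfSurjective hq).symm (q (Pi.single x 1)) = Submodule.Quotient.mk (Pi.single x 1) := by
        rw [LinearEquiv.symm_apply_eq]; rfl
      simp [this]
    obtain ⟨g, hg⟩ := h2
    obtain ⟨h, rfl⟩ := hN g
    obtain ⟨w, rfl⟩ := (theta_bijective R N F).2 h
    refine ⟨w, (theta_bijective R N _).1 ?_⟩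
    rw [theta_nat, theta_nat, hg]
  have hex : Function.Exact q.dualMap r.dualMap := by
    intro φ
    constructor
    · intro h
      have hle : LinearMap.ker q ≤ LinearMap.ker φ := by
        intro x hx
        obtain ⟨z, rfl⟩ := (hqr x).1 hx
        exact LinearMap.congr_fun h z
      refine ⟨((LinearMap.ker q).liftQ _ hle).comp (q.quotKerEquivOfSurjective hq).symm.toLinearMap, ?_⟩
      ext x
      have : (q.quotKerEquivOfSurjective hq).symm (q (Pi.single x 1)) = Submodule.Quotient.mk (Pi.single x 1) := by
        rw [LinearEquiv.symm_apply_eq]; rfl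
      simp [this]
    · rintro ⟨g, rfl⟩
      ext x
      simp [hqr.apply_apply_eq_zero]
  have hqinj : Function.Injective q.dualMap := LinearMap.dualMap_injective_of_surjective hq
  let B : Submodule R (Module.Dual R (Fin b → R)) := LinearMap.range r.dualMap
  let C := Module.Dual R (Fin b → R) ⧸ B
  let rr : Module.Dual R (Fin a → R) →ₗ[R] B := r.dualMap.rangeRestrict
  have hrr : Function.Surjective rr := r.dualMap.surjective_rangeRestrict
  have hrr0 : B.subtype.comp rr = r.dualMap := rfl
  have hexr : Function.Exact q.dualMap rr := by
    intro x
    rw [← hex x]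
    exact Subtype.ext_iff
  have hz (z : TensorProduct R N (Module.Dual R Y)) : rr.lTensor N (q.dualMap.lTensor N z) = 0 := by
    rw [← LinearMap.comp_apply, ← LinearMap.lTensor_comp, hexr.linearMap_comp_eq_zero, LinearMap.lTensor_zero,
      LinearMap.zero_apply]
  have hBinj : Function.Injective (B.subtype.lTensor N) := by
    rw [injective_iff_map_eq_zero]
    intro x hx
    obtain ⟨y, rfl⟩ := LinearMap.lTensor_surjective N hrr x
    rw [← LinearMap.comp_apply, ← LinearMap.lTensor_comp, hrr0] at hx
    obtain ⟨w, rfl⟩ := key y hx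
    exact hz _
  let S1 : ShortComplex (ModuleCat.{0} R) :=
    ShortComplex.mk (ModuleCat.ofHom (X := B) (Y := Module.Dual R (Fin b → R)) B.subtype)
      (ModuleCat.ofHom (X := Module.Dual R (Fin b → R)) (Y := C) B.mkQ) (by ext x; exact (Submodule.Quotient.mk_eq_zero B).2 x.2)
  have hS1 : S1.ShortExact := ModuleCat.shortComplex_shortExact S1
    (LinearMap.exact_subtype_mkQ B) B.injective_subtype B.mkQ_surjective
  let S2 : ShortComplex (ModuleCat.{0} R) :=
    ShortComplex.mk (ModuleCat.ofHom (X := Module.Dual R Y) (Y := Module.Dual R (Fin a → R)) q.dualMap)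
      (ModuleCat.ofHom (X := Module.Dual R (Fin a → R)) (Y := B) rr) (by ext1; exact LinearMap.ext fun x => hexr.apply_apply_eq_zero x)
  have hS2 : S2.ShortExact := ModuleCat.shortComplex_shortExact S2 hexr hqinj hrr
  have p1 : Projective S1.X₂ := (IsProjective.iff_projective _).1
    (inferInstanceAs (Module.Projective R (Module.Dual R (Fin b → R))))
  have p2 : Projective S2.X₂ := (IsProjective.iff_projective _).1
    (inferInstanceAs (Module.Projective R (Module.Dual R (Fin a → R))))
  have t1 : Subsingleton (tor R 1 N S1.X₃) := (tor_one R N S1 hS1).2 hBinj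
  obtain ⟨t2, hpd⟩ := hrt S1.X₃ (inferInstanceAs (Module.Finite R C)) 1 le_rfl t1
  have t3 : Subsingleton (tor R 1 N S2.X₃) := (tor_succ R N S1 hS1 0).1 t2
  have hinj : Function.Injective (q.dualMap.lTensor N) := (tor_one R N S2 hS2).1 t3
  constructor
  · have hsurj : Function.Surjective (i.dualMap.lTensor N) := by
      intro z
      obtain ⟨w, hw⟩ := key (q.dualMap.lTensor N z) ((by
        rw [← LinearMap.comp_apply, ← LinearMap.lTensor_comp, hex.linearMap_comp_eq_zero]; simp))
      exact ⟨w, (hinj hw).symm⟩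
    rw [← LinearMap.range_eq_top, ← Submodule.Quotient.subsingleton_iff]
    have hfin : Module.Finite R (Module.Dual R Y) := Module.Finite.of_injective _ hqinj
    apply subsingleton_of_tensor R N
    have e := lTensor_exact N (LinearMap.exact_map_mkQ_range i.dualMap) (Submodule.mkQ_surjective _)
    have s := LinearMap.lTensor_surjective N (LinearMap.range i.dualMap).mkQ_surjective
    refine subsingleton_of_forall_eq 0 fun x => ?_
    obtain ⟨y, rfl⟩ := s x
    obtain ⟨z, rfl⟩ := hsurj y
    exact e.apply_apply_eq_zero z
  · obtain ⟨n, hn⟩ := (projDim_lt_top_iff R _).1 hpd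
    have h3 : HasProjectiveDimensionLT S1.X₃ (n + 2) := hasProjectiveDimensionLT_of_ge _ n _ (by omega)
    have h1 := (hS1.hasProjectiveDimensionLT_X₃_iff n p1).1 h3
    have h4 : HasProjectiveDimensionLT S2.X₃ (n + 2) := 
      @hasProjectiveDimensionLT_of_ge _ _ _ _ (n+1) _ (by omega) h1
    exact ⟨n + 1, (hS2.hasProjectiveDimensionLT_X₃_iff n p2).1 h4⟩

open Abelian in
lemma extR [IsNoetherianRing R] [IsLocalRing R] (N : ModuleCat.{0} R) [Module.Finite R N] [Nontrivial N]
    (hrt : RigidTest R N) (j : ℕ) : ∀ (X : Type) [AddCommGroup X] [Module R X] [Module.Finite R X],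
    Subsingleton (Ext.{0} (ModuleCat.of R X) N (j + 1)) →
      Subsingleton (Ext.{0} (ModuleCat.of R X) (ModuleCat.of R R) (j + 1)) := by
  induction j with
  | zero =>
    intro X _ _ _ h
    obtain ⟨m, f, hf⟩ := Module.Finite.exists_fin' R X
    have hS := LinearMap.shortExact_shortComplexKer hf
    have hp : Projective f.shortComplexKer.X₂ := (IsProjective.iff_projective _).1
      (inferInstanceAs (Module.Projective R (Fin m → R)))
    have h1 := (ext_one_iff R _ hS N).1 h
    refine (ext_one_iff R _ hS (ModuleCat.of R R)).2 ?_
    have h2 := (keyA R N hrt (LinearMap.ker f) (Fin m → R) (LinearMap.ker f).subtype ?_).1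
    · intro g
      obtain ⟨φ, hφ⟩ := h2 g.hom
      refine ⟨ModuleCat.ofHom φ, ?_⟩
      ext1
      exact hφ
    · intro g
      obtain ⟨h, hh⟩ := h1 (ModuleCat.ofHom g)
      exact ⟨h.hom, congrArg ModuleCat.Hom.hom hh⟩
  | succ j ih =>
    intro X _ _ _ h
    obtain ⟨m, f, hf⟩ := Module.Finite.exists_fin' R X
    have hS := LinearMap.shortExact_shortComplexKer hf
    have hp : Projective f.shortComplexKer.X₂ := (IsProjective.iff_projective _).1
      (inferInstanceAs (Module.Projective R (Fin m → R)))
    refine (ext_shift R _ hS _ j).1 (ih (LinearMap.ker f) ?_)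
    exact (ext_shift R _ hS N j).2 h

open Abelian in
lemma ext_pi (Y : ModuleCat.{0} R) (n m : ℕ) (h : Subsingleton (Ext.{0} Y (ModuleCat.of R R) (n + 1))) :
    Subsingleton (Ext.{0} Y (ModuleCat.of R (Fin m → R)) (n + 1)) := by
  let P := projectiveResolution Y
  rw [ext_iff_cocycle R P] at h ⊢
  intro f hf
  have h1 (i : Fin m) := h (f ≫ ModuleCat.ofHom (LinearMap.proj i)) (by
    rw [← Category.assoc, hf, Limits.zero_comp])
  choose g hg using h1
  refine ⟨ModuleCat.ofHom (LinearMap.pi fun i => (g i).hom), ?_⟩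
  ext1
  refine LinearMap.ext fun x => funext fun i => ?_
  exact LinearMap.congr_fun (congrArg ModuleCat.Hom.hom (hg i)) x

open Abelian in
lemma pd_bound [IsNoetherianRing R] (Y : ModuleCat.{0} R) [Module.Finite R Y] (d : ℕ)
    (h : ∀ i, d < i → Subsingleton (Ext.{0} Y (ModuleCat.of R R) i)) (k : ℕ)
    (hp : HasProjectiveDimensionLT Y (d + 1 + k)) : HasProjectiveDimensionLT Y (d + 1) := by
  induction k with
  | zero => exact hp
  | succ k ih =>
    apply ih
    refine ModuleCat.hasProjectiveDimensionLT_of_forall_finite Y _ fun L hL => ?_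
    obtain ⟨m, f, hf⟩ := Module.Finite.exists_fin' R L
    have hS := LinearMap.shortExact_shortComplexKer hf
    refine subsingleton_of_forall_eq 0 fun x => ?_
    have s1 : Subsingleton (Ext.{0} Y (ModuleCat.of R (LinearMap.ker f)) (d + 1 + k + 1)) :=
      HasProjectiveDimensionLT.subsingleton Y (d + 1 + (k + 1)) _ (by omega) _
    have s2 : Subsingleton (Ext.{0} Y (ModuleCat.of R (Fin m → R)) (d + 1 + k)) := by
      have := ext_pi R Y (d + k) m (h _ (by omega))
      rwa [show d + k + 1 = d + 1 + k by omega] at this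
    obtain ⟨y, hy⟩ := Ext.covariant_sequence_exact₃ Y hS x rfl (Subsingleton.elim _ _)
    rw [← hy, Subsingleton.elim y 0, Ext.zero_comp]

/-- the dual of a short exact sequence -/
def dualSC {F Y : Type} [AddCommGroup F] [Module R F] [AddCommGroup Y] [Module R Y] (q : F →ₗ[R] Y) :
    ShortComplex (ModuleCat.{0} R) :=
  ShortComplex.mk (ModuleCat.ofHom (X := Module.Dual R Y) (Y := Module.Dual R F) q.dualMap)
    (ModuleCat.ofHom (X := Module.Dual R F) (Y := Module.Dual R (LinearMap.ker q)) (LinearMap.ker q).subtype.dualMap)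
    (by
      ext1
      refine LinearMap.ext fun φ => LinearMap.ext fun x => ?_
      exact (congrArg φ x.2).trans (map_zero φ))

lemma dualSC_shortExact {F Y : Type} [AddCommGroup F] [Module R F] [AddCommGroup Y] [Module R Y] (q : F →ₗ[R] Y)
    (hq : Function.Surjective q) (hs : Function.Surjective (LinearMap.ker q).subtype.dualMap) :
    (dualSC R q).ShortExact := by
  refine ModuleCat.shortComplex_shortExact (dualSC R q) ?_ (LinearMap.dualMap_injective_of_surjective hq) hs
  intro φ
  constructor
  · intro h
    change Module.Dual R F at φ
    have hle : LinearMap.ker q ≤ LinearMap.ker φ := fun x hx => LinearMap.congr_fun h ⟨x, hx⟩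
    refine ⟨((LinearMap.ker q).liftQ _ hle).comp (q.quotKerEquivOfSurjective hq).symm.toLinearMap, ?_⟩
    refine LinearMap.ext fun x => ?_
    have : (q.quotKerEquivOfSurjective hq).symm (q x) = Submodule.Quotient.mk x := by
      rw [LinearEquiv.symm_apply_eq]; rfl
    exact (congrArg ((LinearMap.ker q).liftQ _ hle) this)
  · rintro ⟨g, rfl⟩
    change Module.Dual R Y at g
    refine LinearMap.ext fun x => ?_
    exact (congrArg g x.2).trans (map_zero g)

instance dual_finite [IsNoetherianRing R] (Y : Type) [AddCommGroup Y] [Module R Y] [Module.Finite R Y] :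
    Module.Finite R (Module.Dual R Y) := by
  obtain ⟨m, f, hf⟩ := Module.Finite.exists_fin' R Y
  exact Module.Finite.of_injective _ (LinearMap.dualMap_injective_of_surjective hf)

open Abelian in
lemma sub_ext (N : ModuleCat.{0} R) {Y : Type} [AddCommGroup Y] [Module R Y] {m : ℕ}
    (f : (Fin m → R) →ₗ[R] Y) (hf : Function.Surjective f) (n : ℕ)
    (h : ∀ j, n + 1 < j → Subsingleton (Ext.{0} (ModuleCat.of R Y) N j)) (j : ℕ) (hj : n < j) :
    Subsingleton (Ext.{0} (ModuleCat.of R (LinearMap.ker f)) N j) := by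
  obtain ⟨j, rfl⟩ : ∃ k, j = k + 1 := ⟨j - 1, by omega⟩
  have hS := LinearMap.shortExact_shortComplexKer hf
  have hp : Projective f.shortComplexKer.X₂ := (IsProjective.iff_projective _).1
    (inferInstanceAs (Module.Projective R (Fin m → R)))
  exact (ext_shift R _ hS N j).2 (h _ (by omega))

open Abelian in
lemma keyB [IsNoetherianRing R] [IsLocalRing R] (N : ModuleCat.{0} R) [Module.Finite R N] [Nontrivial N]
    (hrt : RigidTest R N) {Y : Type} [AddCommGroup Y] [Module R Y] {m : ℕ}
    (f : (Fin m → R) →ₗ[R] Y) (hf : Function.Surjective f)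
    (h : Subsingleton (Ext.{0} (ModuleCat.of R Y) N 1)) :
    Function.Surjective (LinearMap.ker f).subtype.dualMap ∧
      ∃ n, HasProjectiveDimensionLT (ModuleCat.of R (Module.Dual R (LinearMap.ker f))) n := by
  have hS := LinearMap.shortExact_shortComplexKer hf
  have hp : Projective f.shortComplexKer.X₂ := (IsProjective.iff_projective _).1
    (inferInstanceAs (Module.Projective R (Fin m → R)))
  refine keyA R N hrt (LinearMap.ker f) (Fin m → R) (LinearMap.ker f).subtype fun g => ?_
  obtain ⟨h, hh⟩ := (ext_one_iff R _ hS N).1 h (ModuleCat.ofHom g)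
  exact ⟨h.hom, congrArg ModuleCat.Hom.hom hh⟩

open Abelian in
lemma dualpd [IsNoetherianRing R] [IsLocalRing R] (N : ModuleCat.{0} R) [Module.Finite R N] [Nontrivial N]
    (hrt : RigidTest R N) (d : ℕ) (hd : ∀ (X : ModuleCat.{0} R) (i : ℕ), d < i → Subsingleton (Ext.{0} X N i))
    (n : ℕ) (hn : n ≤ d) : ∀ (Y : Type) [AddCommGroup Y] [Module R Y] (m : ℕ)
    (f : (Fin m → R) →ₗ[R] Y) (_ : Function.Surjective f)
    (_ : ∀ j, 0 < j → Subsingleton (Ext.{0} (ModuleCat.of R Y) N j)),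
      HasProjectiveDimensionLT (ModuleCat.of R (Module.Dual R (LinearMap.ker f))) (d + 1 - n) := by
  induction n with
  | zero =>
    intro Y _ _ m f hf hY
    obtain ⟨_, p, hp⟩ := keyB R N hrt f hf (hY 1 one_pos)
    have hfin : Module.Finite R (ModuleCat.of R (Module.Dual R (LinearMap.ker f))) :=
      dual_finite R (LinearMap.ker f)
    refine pd_bound R _ d (fun i hi => ?_) p (hasProjectiveDimensionLT_of_ge _ p _ (by omega))
    obtain ⟨j, rfl⟩ : ∃ k, i = k + 1 := ⟨i - 1, by omega⟩
    exact extR R N hrt j (Module.Dual R (LinearMap.ker f)) (hd _ _ hi)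
  | succ n ih =>
    intro Y _ _ m f hf hY
    have hY' := sub_ext R N f hf 0 (fun j hj => hY j (by omega))
    obtain ⟨b, q, hq⟩ := Module.Finite.exists_fin' R (LinearMap.ker f)
    have h1 := ih (by omega) (LinearMap.ker f) b q hq hY'
    have hS := dualSC_shortExact R q hq (keyB R N hrt q hq (hY' 1 one_pos)).1
    have hp : Projective (dualSC R q).X₂ := (IsProjective.iff_projective _).1
      (inferInstanceAs (Module.Projective R (Module.Dual R (Fin b → R))))
    have hp1 : HasProjectiveDimensionLT (dualSC R q).X₂ 1 := inferInstance
    refine hS.hasProjectiveDimensionLT_X₁ _ (hasProjectiveDimensionLT_of_ge _ 1 _ (by omega)) ?_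
    rw [show d + 1 - (n + 1) + 1 = d + 1 - n by omega]
    exact h1

open Abelian in
lemma syz_proj [IsNoetherianRing R] [IsLocalRing R] (N : ModuleCat.{0} R) [Module.Finite R N] [Nontrivial N]
    (hrt : RigidTest R N) (d : ℕ) (hd : ∀ (X : ModuleCat.{0} R) (i : ℕ), d < i → Subsingleton (Ext.{0} X N i))
    (Y : Type) [AddCommGroup Y] [Module R Y] (m : ℕ)
    (f : (Fin m → R) →ₗ[R] Y) (hf : Function.Surjective f)
    (hY : ∀ j, 0 < j → Subsingleton (Ext.{0} (ModuleCat.of R Y) N j)) :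
    Module.Projective R (LinearMap.ker f) := by
  have hY' := sub_ext R N f hf 0 (fun j hj => hY j (by omega))
  obtain ⟨b, q, hq⟩ := Module.Finite.exists_fin' R (LinearMap.ker f)
  have proj (Z : Type) [AddCommGroup Z] [Module R Z] (m : ℕ) (g : (Fin m → R) →ₗ[R] Z)
      (hg : Function.Surjective g) (hZ : ∀ j, 0 < j → Subsingleton (Ext.{0} (ModuleCat.of R Z) N j)) :
      Module.Projective R (Module.Dual R (LinearMap.ker g)) := by
    have := dualpd R N hrt d hd d le_rfl Z m g hg hZ
    rw [show d + 1 - d = 1 by omega, ← projective_iff_hasProjectiveDimensionLT_one] at this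
    exact (IsProjective.iff_projective (ModuleCat.of R (Module.Dual R (LinearMap.ker g)))).2 this
  have p1 := proj Y m f hf hY
  have p2 := proj (LinearMap.ker f) b q hq hY'
  have hsurj := (keyB R N hrt q hq (hY' 1 one_pos)).1
  have hqinj : Function.Injective q.dualMap := LinearMap.dualMap_injective_of_surjective hq
  have hex : Function.Exact q.dualMap (LinearMap.ker q).subtype.dualMap :=
    (ShortComplex.ShortExact.moduleCat_exact_iff_function_exact _).1 (dualSC_shortExact R q hq hsurj).exact
  obtain ⟨s, hs⟩ := Module.projective_lifting_property _ LinearMap.id hsurj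
  have hr : ∃ r : Module.Dual R (Fin b → R) →ₗ[R] Module.Dual R (LinearMap.ker f), r.comp q.dualMap = LinearMap.id :=
    (hex.split_tfae hqinj hsurj _ (by simp) _ (by simp)).1
      (show ∃ l, (LinearMap.ker q).subtype.dualMap ∘ₗ l = LinearMap.id from ⟨s, hs⟩)
  obtain ⟨r, hr⟩ := hr
  have hbij : Function.Bijective (Module.Dual.eval R (LinearMap.ker f)) := by
    constructor
    · rw [injective_iff_map_eq_zero]
      intro x hx
      apply Subtype.ext
      funext i
      exact LinearMap.congr_fun hx ((LinearMap.proj i).comp (LinearMap.ker f).subtype)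
    · intro φ
      obtain ⟨x, hx⟩ := (Module.bijective_dual_eval R (Fin b → R)).2 (φ.comp r)
      refine ⟨q x, LinearMap.ext fun ψ => ?_⟩
      have h1 := LinearMap.congr_fun hx (q.dualMap ψ)
      have h2 : r (q.dualMap ψ) = ψ := LinearMap.congr_fun hr ψ
      rw [LinearMap.comp_apply, h2] at h1
      exact h1
  have p3 : Module.Projective R (Module.Dual R (Module.Dual R (LinearMap.ker f))) := inferInstance
  exact Module.Projective.of_equiv (LinearEquiv.ofBijective _ hbij).symm

open Abelian in
lemma fin_pd [IsNoetherianRing R] [IsLocalRing R] (N : ModuleCat.{0} R) [Module.Finite R N] [Nontrivial N]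
    (hrt : RigidTest R N) (d : ℕ) (hd : ∀ (X : ModuleCat.{0} R) (i : ℕ), d < i → Subsingleton (Ext.{0} X N i))
    (n : ℕ) : ∀ (X : Type) [AddCommGroup X] [Module R X] [Module.Finite R X]
      (_ : ∀ j, n < j → Subsingleton (Ext.{0} (ModuleCat.of R X) N j)),
      ∃ p, HasProjectiveDimensionLT (ModuleCat.of R X) p := by
  induction n with
  | zero =>
    intro X _ _ _ h
    obtain ⟨m, f, hf⟩ := Module.Finite.exists_fin' R X
    have hS := LinearMap.shortExact_shortComplexKer hf
    have hp : Projective f.shortComplexKer.X₂ := (IsProjective.iff_projective _).1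
      (inferInstanceAs (Module.Projective R (Fin m → R)))
    have hk : Projective f.shortComplexKer.X₁ := (IsProjective.iff_projective _).1
      (syz_proj R N hrt d hd X m f hf h)
    exact ⟨2, (hS.hasProjectiveDimensionLT_X₃_iff 0 hp).2 inferInstance⟩
  | succ n ih =>
    intro X _ _ _ h
    obtain ⟨m, f, hf⟩ := Module.Finite.exists_fin' R X
    have hS := LinearMap.shortExact_shortComplexKer hf
    have hp : Projective f.shortComplexKer.X₂ := (IsProjective.iff_projective _).1
      (inferInstanceAs (Module.Projective R (Fin m → R)))
    obtain ⟨p, hpd⟩ := ih (LinearMap.ker f) (sub_ext R N f hf n h)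
    exact ⟨p + 2, (hS.hasProjectiveDimensionLT_X₃_iff p hp).2 (hasProjectiveDimensionLT_of_ge _ p _ (by omega))⟩

/-- a local ring admitting a nonzero f.g. rigid-test module of
finite projective or finite injective dimension is regular (the residue field
has finite projective dimension). -/
theorem stmt9 [IsNoetherianRing R] [IsLocalRing R]
    (N : ModuleCat R) [Module.Finite R N] (hN : Nontrivial N)
    (hrt : RigidTest R N)
    (h : projDim R N < ⊤ ∨ injDim R N < ⊤) :
    projDim R (ModuleCat.of R (IsLocalRing.ResidueField R)) < ⊤ := by
  rcases h with h | h
  · exact pd_case R N hrt h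
  · obtain ⟨d, hd⟩ := injDim_lt_top R N h
    exact (projDim_lt_top_iff R _).2 (fin_pd R N hrt d hd d (IsLocalRing.ResidueField R) (hd _))
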